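/- Suppose premiums are adjusted according to aggregate reported claims. Then for every integer u ≥ 0, every i ∈ {1,…,l} and every n ≥ 1: ψ_i(u,n+1) = Σ_{j=1}^l Σ_{x=0}^{u+c_i} Σ_{y=0}^{u+c_i−x} t_{ij}(x+y)·ψ_j(u+c_i−x−y, n)·f_{XY}(x,y) + q·Σ_{j=1}^l Σ_{y=1}^{c_j} t_{ij}(u+c_i+y)·ψ'_j(0;y,n)·ξ_y(u+c_i) + q·Σ_{j=1}^l Σ_{y=c_j+1}^∞ t_{ij}(u+c_i+y)·ξ_y(u+c_i) + (1−q)·Σ_{y=1}^∞ ξ_y(u+c_i) + Σ_{x=u+c_i+1}^∞ f_X(x), and moreover ψ_i(u,1) = (1−q)·Σ_{y=1}^∞ ξ_y(u+c_i) + Σ_{x=u+c_i+1}^∞ f_X(x). -/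

import Mathlib

open scoped BigOperators

noncomputable section

namespace DelayedClaims

/-- Marginal pmf of the main claim: `f_X(x) = Σ_y f_{XY}(x,y)`. -/
def fX (f : ℕ → ℕ → ℝ) (x : ℕ) : ℝ := ∑' y : ℕ, f x y

/-- `ξ_y(m) = Σ_{x=1}^m f_{XY}(x, y + m - x)`. -/
def xi (f : ℕ → ℕ → ℝ) (y m : ℕ) : ℝ := ∑ x ∈ Finset.Icc 1 m, f x (y + m - x)

/-- Probability weight of a single period outcome `(x, y, d)`:
`d = true` means the settlement of the by-claim `y` is delayed (probability `q`). -/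
def w (f : ℕ → ℕ → ℝ) (q : ℝ) (p : ℕ × ℕ × Bool) : ℝ :=
  f p.1 p.2.1 * (if p.2.2 then q else 1 - q)

/-- Probability weight of an `n`-period path of i.i.d. period outcomes. -/
def pathWeight (f : ℕ → ℕ → ℝ) (q : ℝ) (n : ℕ) (ω : Fin n → ℕ × ℕ × Bool) : ℝ :=
  ∏ s : Fin n, w f q (ω s)

/-- Ruin indicator along a path.  Here `c` lists the premium levels,
`T i s` is the premium level following level `i` when the period adjustment
statistic equals `s`, `stat x y d carry` is the period adjustment statistic,
`i` is the current premium level, `u` the current surplus, and `carry` the amount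
of the by-claim whose settlement was delayed from the previous period (`0` if none).
In each period the premium `c i` is received up front and the settled amount
`x + (1-d)·y + carry` is paid at the end of the period; ruin occurs as soon as
the surplus becomes negative at the end of some period. -/
def ruined (l : ℕ) (c : Fin l → ℕ) (T : Fin l → ℕ → Fin l)
    (stat : ℕ → ℕ → Bool → ℕ → ℕ) :
    (n : ℕ) → (Fin n → ℕ × ℕ × Bool) → Fin l → ℤ → ℕ → Bool
  | 0, _, _, _, _ => false
  | n + 1, ω, i, u, carry =>
    let x : ℕ := (ω 0).1
    let y : ℕ := (ω 0).2.1
    let d : Bool := (ω 0).2.2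
    let u' : ℤ := u + (c i : ℤ) - ((x : ℤ) + (if d then 0 else (y : ℤ)) + (carry : ℤ))
    if u' < 0 then true
    else ruined l c T stat n (fun s => ω s.succ) (T i (stat x y d carry)) u'
      (if d then y else 0)

/-- `ψ'_i(u; z, n)`: the finite-time ruin probability over horizon `n` of the model with
an up-front delayed by-claim `z` settled at the end of period 1 (taking `z = 0` gives the
model without an up-front delayed by-claim), with initial premium level `i` and
initial surplus `u`.  By convention it equals `1` for `u < 0` and `0` for `n = 0`. -/
def psiAux (l : ℕ) (c : Fin l → ℕ) (T : Fin l → ℕ → Fin l)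
    (stat : ℕ → ℕ → Bool → ℕ → ℕ) (f : ℕ → ℕ → ℝ) (q : ℝ)
    (i : Fin l) (u : ℤ) (z : ℕ) (n : ℕ) : ℝ :=
  if u < 0 then 1
  else ∑' ω : Fin n → ℕ × ℕ × Bool,
    pathWeight f q n ω * (if ruined l c T stat n ω i u z then 1 else 0)

/-- `ψ_i(u, n)`: finite-time ruin probability without an up-front delayed by-claim. -/
def psi (l : ℕ) (c : Fin l → ℕ) (T : Fin l → ℕ → Fin l)
    (stat : ℕ → ℕ → Bool → ℕ → ℕ) (f : ℕ → ℕ → ℝ) (q : ℝ)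
    (i : Fin l) (u : ℤ) (n : ℕ) : ℝ :=
  psiAux l c T stat f q i u 0 n

/-- Adjustment statistic: aggregate reported claims `X + Y`. -/
def statRep (x y : ℕ) (_ : Bool) (_ : ℕ) : ℕ := x + y

/-- Adjustment statistic: aggregate settled claims `X + (1-D)·Y + carry`. -/
def statSet (x y : ℕ) (d : Bool) (carry : ℕ) : ℕ := x + (if d then 0 else y) + carry

/-- Adjustment statistic: reported number of claims `1{X>0} + 1{Y>0}`. -/
def statRepN (x y : ℕ) (_ : Bool) (_ : ℕ) : ℕ :=
  (if 0 < x then 1 else 0) + (if 0 < y then 1 else 0)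

/-- Adjustment statistic: settled number of claims
`1{X>0} + 1{Y>0 and not delayed} + 1{delayed by-claim from the previous period}`. -/
def statSetN (x y : ℕ) (d : Bool) (carry : ℕ) : ℕ :=
  (if 0 < x then 1 else 0) + (if 0 < y ∧ d = false then 1 else 0) +
    (if 0 < carry then 1 else 0)

lemma summable_pmf {f : ℕ → ℕ → ℝ} (hfsum : ∑' p : ℕ × ℕ, f p.1 p.2 = 1) :
    Summable fun p : ℕ × ℕ => f p.1 p.2 := by
  by_contra h
  rw [tsum_eq_zero_of_not_summable h] at hfsum
  exact zero_ne_one hfsum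

/-- Summation over period outcomes: condition on whether the by-claim is delayed. -/
lemma hasSum_period {f : ℕ → ℕ → ℝ} {q S : ℝ} {g : ℕ × ℕ × Bool → ℝ}
    (hs : Summable fun p => w f q p * g p)
    (h : HasSum (fun p : ℕ × ℕ =>
      f p.1 p.2 * (q * g (p.1, p.2, true) + (1 - q) * g (p.1, p.2, false))) S) :
    HasSum (fun p => w f q p * g p) S := by
  let e := Equiv.prodAssoc ℕ ℕ Bool
  have hs' : Summable fun p => w f q (e p) * g (e p) :=
    (e.summable_iff (f := fun p => w f q p * g p)).2 hs
  have h1 := hs'.hasSum.prod_fiberwise (fun p => hasSum_fintype _)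
  rw [← e.hasSum_iff]
  rw [h.unique (by
    convert h1 using 2 with p
    simp [e, w]
    ring)]
  exact hs'.hasSum

lemma w_nonneg {f : ℕ → ℕ → ℝ} (hfnn : ∀ x y, 0 ≤ f x y) {q : ℝ} (hq0 : 0 ≤ q)
    (hq1 : q ≤ 1) (p : ℕ × ℕ × Bool) : 0 ≤ w f q p := by
  refine mul_nonneg (hfnn _ _) ?_
  split_ifs <;> linarith

lemma summable_w {f : ℕ → ℕ → ℝ} (hs : Summable fun p : ℕ × ℕ => f p.1 p.2) (q : ℝ) :
    Summable (w f q) := by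
  let e := Equiv.prodAssoc ℕ ℕ Bool
  rw [← e.summable_iff]
  exact summable_mul_of_summable_norm (f := fun p : ℕ × ℕ => f p.1 p.2)
    (g := fun d : Bool => if d then q else 1 - q) hs.norm (Summable.of_finite)

lemma hasSum_w {f : ℕ → ℕ → ℝ} (hfsum : ∑' p : ℕ × ℕ, f p.1 p.2 = 1) (q : ℝ) :
    HasSum (w f q) 1 := by
  have hs := summable_pmf hfsum
  have h := hasSum_period (f := f) (q := q) (S := 1) (g := fun _ => 1)
    (by simpa using summable_w hs q) (by simpa [hfsum] using hs.hasSum)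
  simpa using h

lemma pathWeight_nonneg {f : ℕ → ℕ → ℝ} (hfnn : ∀ x y, 0 ≤ f x y) {q : ℝ} (hq0 : 0 ≤ q)
    (hq1 : q ≤ 1) (n : ℕ) (ω : Fin n → ℕ × ℕ × Bool) : 0 ≤ pathWeight f q n ω :=
  Finset.prod_nonneg fun _ _ => w_nonneg hfnn hq0 hq1 _

lemma pathWeight_cons (f : ℕ → ℕ → ℝ) (q : ℝ) (n : ℕ) (p : ℕ × ℕ × Bool)
    (ω : Fin n → ℕ × ℕ × Bool) :
    pathWeight f q (n + 1) (Fin.cons p ω : Fin (n + 1) → ℕ × ℕ × Bool) =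
      w f q p * pathWeight f q n ω := by
  simp [pathWeight, Fin.prod_univ_succ]

lemma hasSum_pathWeight {f : ℕ → ℕ → ℝ} (hfnn : ∀ x y, 0 ≤ f x y)
    (hfsum : ∑' p : ℕ × ℕ, f p.1 p.2 = 1) {q : ℝ} (hq0 : 0 ≤ q) (hq1 : q ≤ 1) (n : ℕ) :
    HasSum (pathWeight f q n) 1 := by
  induction n with
  | zero =>
    convert hasSum_fintype (pathWeight f q 0)
    simp [pathWeight]
  | succ n ih =>
    have hw := hasSum_w hfsum q
    have hs : Summable fun p : (ℕ × ℕ × Bool) × (Fin n → ℕ × ℕ × Bool) =>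
        w f q p.1 * pathWeight f q n p.2 :=
      hw.summable.mul_of_nonneg ih.summable (w_nonneg hfnn hq0 hq1)
        (pathWeight_nonneg hfnn hq0 hq1 n)
    have h := hw.mul ih hs
    rw [← (Fin.consEquiv fun _ : Fin (n + 1) => ℕ × ℕ × Bool).hasSum_iff]
    simpa [Function.comp_def, Fin.consEquiv, pathWeight_cons] using h

section Ruin

variable {l : ℕ} {c : Fin l → ℕ} {T : Fin l → ℕ → Fin l} {f : ℕ → ℕ → ℝ} {q : ℝ}

lemma summable_pathWeight_mul_ruined (hfnn : ∀ x y, 0 ≤ f x y)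
    (hfsum : ∑' p : ℕ × ℕ, f p.1 p.2 = 1) (hq0 : 0 ≤ q) (hq1 : q ≤ 1)
    (stat : ℕ → ℕ → Bool → ℕ → ℕ) (i : Fin l) (u : ℤ) (z n : ℕ) :
    Summable fun ω : Fin n → ℕ × ℕ × Bool =>
      pathWeight f q n ω * (if ruined l c T stat n ω i u z then 1 else 0) := by
  refine Summable.of_nonneg_of_le (fun ω => ?_) (fun ω => ?_)
    (hasSum_pathWeight hfnn hfsum hq0 hq1 n).summable
  all_goals
    have := pathWeight_nonneg hfnn hq0 hq1 n ω
    split_ifs <;> simp [this]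

lemma psiAux_nonneg (hfnn : ∀ x y, 0 ≤ f x y) (hq0 : 0 ≤ q) (hq1 : q ≤ 1)
    (stat : ℕ → ℕ → Bool → ℕ → ℕ) (i : Fin l) (u : ℤ) (z n : ℕ) :
    0 ≤ psiAux l c T stat f q i u z n := by
  unfold psiAux
  split_ifs
  · exact zero_le_one
  · refine tsum_nonneg fun ω => mul_nonneg (pathWeight_nonneg hfnn hq0 hq1 n ω) ?_
    split_ifs <;> norm_num

lemma psiAux_le_one (hfnn : ∀ x y, 0 ≤ f x y)
    (hfsum : ∑' p : ℕ × ℕ, f p.1 p.2 = 1) (hq0 : 0 ≤ q) (hq1 : q ≤ 1)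
    (stat : ℕ → ℕ → Bool → ℕ → ℕ) (i : Fin l) (u : ℤ) (z n : ℕ) :
    psiAux l c T stat f q i u z n ≤ 1 := by
  unfold psiAux
  split_ifs
  · exact le_rfl
  · have h := hasSum_pathWeight hfnn hfsum hq0 hq1 n
    refine ((summable_pathWeight_mul_ruined hfnn hfsum hq0 hq1 stat i u z n).tsum_le_tsum
      (fun ω => ?_) h.summable).trans_eq h.tsum_eq
    have := pathWeight_nonneg hfnn hq0 hq1 n ω
    split_ifs <;> simp [this]

lemma psiAux_of_neg {stat : ℕ → ℕ → Bool → ℕ → ℕ} {i : Fin l} {u : ℤ} (hu : u < 0) (z n : ℕ) :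
    psiAux l c T stat f q i u z n = 1 := if_pos hu

lemma psiAux_zero {stat : ℕ → ℕ → Bool → ℕ → ℕ} {i : Fin l} {u : ℤ} (hu : 0 ≤ u) (z : ℕ) :
    psiAux l c T stat f q i u z 0 = 0 := by
  simp [psiAux, hu.not_gt, ruined]

/-- First-step analysis: condition on the outcome of the first period. -/
lemma psiAux_succ (hfnn : ∀ x y, 0 ≤ f x y)
    (hfsum : ∑' p : ℕ × ℕ, f p.1 p.2 = 1) (hq0 : 0 ≤ q) (hq1 : q ≤ 1)
    (stat : ℕ → ℕ → Bool → ℕ → ℕ) (i : Fin l) {u : ℤ} (hu : 0 ≤ u) (z n : ℕ) :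
    psiAux l c T stat f q i u z (n + 1) =
      ∑' p : ℕ × ℕ × Bool, w f q p *
        psiAux l c T stat f q (T i (stat p.1 p.2.1 p.2.2 z))
          (u + (c i : ℤ) - ((p.1 : ℤ) + (if p.2.2 then 0 else (p.2.1 : ℤ)) + (z : ℤ)))
          (if p.2.2 then p.2.1 else 0) n := by
  have hs := summable_pathWeight_mul_ruined (c := c) (T := T) hfnn hfsum hq0 hq1 stat i u z (n + 1)
  let e := Fin.consEquiv fun _ : Fin (n + 1) => ℕ × ℕ × Bool
  rw [psiAux, if_neg hu.not_gt, ← e.tsum_eq,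
    Summable.tsum_prod (by simpa [Function.comp_def] using e.summable_iff.2 hs)]
  refine tsum_congr fun p => ?_
  have he : ∀ ω, e (p, ω) = (Fin.cons p ω : Fin (n + 1) → ℕ × ℕ × Bool) := fun _ => rfl
  simp only [he, pathWeight_cons, mul_assoc]
  rw [tsum_mul_left]
  congr 1
  by_cases hneg :
      u + (c i : ℤ) - ((p.1 : ℤ) + (if p.2.2 then 0 else (p.2.1 : ℤ)) + (z : ℤ)) < 0
  · rw [psiAux_of_neg hneg]
    simp only [ruined, Fin.cons_zero, hneg, if_true, mul_one]
    exact (hasSum_pathWeight hfnn hfsum hq0 hq1 n).tsum_eq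
  · simp only [psiAux, ruined, Fin.cons_zero, Fin.cons_succ, hneg, if_false]

lemma ruined_statRep_congr (n : ℕ) (ω : Fin n → ℕ × ℕ × Bool) (i : Fin l) {u v : ℤ} {y z : ℕ}
    (h : u - y = v - z) :
    ruined l c T statRep n ω i u y = ruined l c T statRep n ω i v z := by
  cases n with
  | zero => rfl
  | succ n =>
    have h' : ∀ a b : ℤ, u + a - (b + y) = v + a - (b + z) := fun a b => by linarith
    simp only [ruined, h', statRep]

/-- When premiums depend on reported claims only, the surplus and the up-front delayed by-claim
matter only through their difference. -/
lemma psiAux_statRep_congr (n : ℕ) (i : Fin l) {u v : ℤ} (hu : 0 ≤ u) (hv : 0 ≤ v) {y z : ℕ}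
    (h : u - y = v - z) :
    psiAux l c T statRep f q i u y n = psiAux l c T statRep f q i v z n := by
  simp only [psiAux, hu.not_gt, hv.not_gt, if_false, ruined_statRep_congr n _ i h]

lemma psiAux_eq_one (hfnn : ∀ x y, 0 ≤ f x y)
    (hfsum : ∑' p : ℕ × ℕ, f p.1 p.2 = 1) (hq0 : 0 ≤ q) (hq1 : q ≤ 1)
    (stat : ℕ → ℕ → Bool → ℕ → ℕ) (i : Fin l) {z n : ℕ} (hz : c i < z) (hn : 1 ≤ n) :
    psiAux l c T stat f q i 0 z n = 1 := by
  obtain ⟨n, rfl⟩ := Nat.exists_eq_add_of_le' hn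
  rw [psiAux_succ hfnn hfsum hq0 hq1 stat i le_rfl]
  rw [← (hasSum_w hfsum q).tsum_eq]
  refine tsum_congr fun p => ?_
  rw [psiAux_of_neg, mul_one]
  split_ifs <;> omega

end Ruin

section Claims

variable {f : ℕ → ℕ → ℝ}

lemma summable_mul_of_bounded {ι : Type*} {a b : ι → ℝ} (ha : Summable a) (ha0 : ∀ k, 0 ≤ a k)
    (hb0 : ∀ k, 0 ≤ b k) (hb1 : ∀ k, b k ≤ 1) : Summable fun k => a k * b k :=
  ha.of_nonneg_of_le (fun k => mul_nonneg (ha0 k) (hb0 k))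
    fun k => mul_le_of_le_one_right (ha0 k) (hb1 k)

/-- The total mass of `{X > m}`. -/
lemma hasSum_main_claim_gt (hs : Summable fun p : ℕ × ℕ => f p.1 p.2)
    (m : ℕ) :
    HasSum (fun p : ℕ × ℕ => if m < p.1 then f p.1 p.2 else 0) (∑' k, fX f (m + 1 + k)) := by
  have h1 : Summable fun p : ℕ × ℕ => if m < p.1 then f p.1 p.2 else 0 := by
    exact (hs.indicator {p : ℕ × ℕ | m < p.1}).congr fun p => by simp [Set.indicator_apply]
  have h2 : ∀ x, ∑' y, (if m < x then f x y else 0) = if m < x then fX f x else 0 := by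
    intro x
    split_ifs <;> simp [fX]
  have h3 := h1.prod
  simp only [h2] at h3
  convert h1.hasSum using 1
  rw [h1.tsum_prod]
  simp only [h2]
  rw [← h3.sum_add_tsum_nat_add (m + 1), Finset.sum_eq_zero, zero_add]
  · refine tsum_congr fun k => ?_
    rw [if_pos (by omega), add_comm]
  · intro x hx
    rw [if_neg (by simp at hx; omega)]

lemma summable_shift (hs : Summable fun p : ℕ × ℕ => f p.1 p.2) (x a : ℕ) :
    Summable fun k => f x (k + a) :=
  (summable_nat_add_iff a).2 (hs.prod_factor x)

lemma xi_eq (hfdeg : ∀ y : ℕ, 0 < y → f 0 y = 0) (k m : ℕ) :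
    xi f (k + 1) m = ∑ x ∈ Finset.range (m + 1), f x (k + (m + 1 - x)) := by
  rw [xi, Finset.sum_range_succ', hfdeg _ (by omega), add_zero, Finset.range_eq_Ico,
    Finset.sum_Ico_add' (fun x => f x (k + (m + 1 - x))) 0 m 1]
  refine Finset.sum_congr rfl fun x hx => ?_
  rw [Finset.mem_Ico] at hx
  congr 1
  omega

lemma xi_nonneg (hfnn : ∀ x y, 0 ≤ f x y) (k m : ℕ) : 0 ≤ xi f k m :=
  Finset.sum_nonneg fun _ _ => hfnn _ _

lemma summable_xi (hs : Summable fun p : ℕ × ℕ => f p.1 p.2)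
    (hfdeg : ∀ y : ℕ, 0 < y → f 0 y = 0) (m : ℕ) : Summable fun k => xi f (k + 1) m := by
  simp only [xi_eq hfdeg]
  exact summable_sum fun x _ => summable_shift hs x _

/-- Summation over `{X ≤ m < X + Y}` of a bounded function of the overshoot `X + Y - m`. -/
lemma hasSum_overshoot (hfnn : ∀ x y, 0 ≤ f x y) (hs : Summable fun p : ℕ × ℕ => f p.1 p.2)
    (hfdeg : ∀ y : ℕ, 0 < y → f 0 y = 0) (m : ℕ) {H : ℕ → ℝ} (hH0 : ∀ k, 0 ≤ H k)
    (hH1 : ∀ k, H k ≤ 1) :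
    HasSum (fun p : ℕ × ℕ =>
        if p.1 ≤ m ∧ m < p.1 + p.2 then f p.1 p.2 * H (p.1 + p.2 - m) else 0)
      (∑' k, xi f (k + 1) m * H (k + 1)) := by
  have h1 : Summable fun p : ℕ × ℕ =>
      if p.1 ≤ m ∧ m < p.1 + p.2 then f p.1 p.2 * H (p.1 + p.2 - m) else 0 := by
    exact ((summable_mul_of_bounded hs (fun p => hfnn p.1 p.2) (b := fun p => H (p.1 + p.2 - m))
        (fun _ => hH0 _) (fun _ => hH1 _)).indicator {p : ℕ × ℕ | p.1 ≤ m ∧ m < p.1 + p.2}).congr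
        fun p => by simp [Set.indicator_apply]
  convert h1.hasSum using 1
  have h2 : ∀ x ∈ Finset.range (m + 1),
      ∑' y, (if x ≤ m ∧ m < x + y then f x y * H (x + y - m) else 0) =
        ∑' k, f x (k + (m + 1 - x)) * H (k + 1) := by
    intro x hx
    rw [Finset.mem_range] at hx
    rw [← (h1.prod_factor x).sum_add_tsum_nat_add (m + 1 - x), Finset.sum_eq_zero, zero_add]
    · refine tsum_congr fun k => ?_
      rw [if_pos (by omega)]
      congr 2
      simp only
      omega
    · intro y hy
      rw [Finset.mem_range] at hy
      rw [if_neg (by simp only; omega)]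
  rw [h1.tsum_prod, tsum_eq_sum (f := fun x => ∑' y, _) (s := Finset.range (m + 1)),
    Finset.sum_congr rfl h2]
  · simp only [xi_eq hfdeg, Finset.sum_mul]
    exact Summable.tsum_finsetSum fun x _ => summable_mul_of_bounded
      (summable_shift hs x _) (fun _ => hfnn _ _)
      (b := fun k => H (k + 1)) (fun _ => hH0 _) (fun _ => hH1 _)
  · intro x hx
    rw [Finset.mem_range] at hx
    have : ¬ x ≤ m := by omega
    simp [this]

/-- Summation over `{X + Y ≤ m}`. -/
lemma hasSum_total_le (m : ℕ) (g : ℕ → ℕ → ℝ) :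
    HasSum (fun p : ℕ × ℕ => if p.1 + p.2 ≤ m then g p.1 p.2 else 0)
      (∑ x ∈ Finset.range (m + 1), ∑ y ∈ Finset.range (m - x + 1), g x y) := by
  have hsum := hasSum_sum_of_ne_finset_zero (L := .unconditional _)
    (f := fun p : ℕ × ℕ => if p.1 + p.2 ≤ m then g p.1 p.2 else 0)
    (s := Finset.range (m + 1) ×ˢ Finset.range (m + 1)) (fun p hp => by
      simp only [Finset.mem_product, Finset.mem_range] at hp
      rw [if_neg (by omega)])
  convert hsum using 1
  rw [Finset.sum_product]
  refine Finset.sum_congr rfl fun x hx => ?_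
  rw [Finset.mem_range] at hx
  rw [← Finset.sum_filter]
  refine Finset.sum_congr ?_ fun _ _ => rfl
  ext y
  simp only [Finset.mem_filter, Finset.mem_range]
  omega

end Claims

/-- First-step recursion for `ψ` under reported aggregate claims, in terms of the transition
map `T`, for an arbitrary remaining horizon. -/
lemma psi_statRep_succ {l : ℕ} {c : Fin l → ℕ} {T : Fin l → ℕ → Fin l} {f : ℕ → ℕ → ℝ} {q : ℝ}
    (hfnn : ∀ x y, 0 ≤ f x y)
    (hfsum : ∑' p : ℕ × ℕ, f p.1 p.2 = 1) (hfdeg : ∀ y : ℕ, 0 < y → f 0 y = 0)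
    (hq0 : 0 ≤ q) (hq1 : q ≤ 1) (u : ℕ) (i : Fin l) (n : ℕ) :
    psi l c T statRep f q i (u : ℤ) (n + 1) =
      (∑ x ∈ Finset.range (u + c i + 1), ∑ y ∈ Finset.range (u + c i - x + 1),
        f x y * psi l c T statRep f q (T i (x + y)) ((u + c i - x - y : ℕ) : ℤ) n)
      + q * (∑' k : ℕ, xi f (k + 1) (u + c i) *
          psiAux l c T statRep f q (T i (u + c i + (k + 1))) 0 (k + 1) n)
      + (1 - q) * (∑' k : ℕ, xi f (k + 1) (u + c i))
      + (∑' k : ℕ, fX f (u + c i + 1 + k)) := by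
  have hs := summable_pmf hfsum
  rw [psi, psiAux_succ hfnn hfsum hq0 hq1 statRep i (Int.natCast_nonneg u)]
  refine (hasSum_period (summable_mul_of_bounded (hasSum_w hfsum q).summable
    (w_nonneg hfnn hq0 hq1) (fun _ => psiAux_nonneg hfnn hq0 hq1 _ _ _ _ _)
    (fun _ => psiAux_le_one hfnn hfsum hq0 hq1 _ _ _ _ _)) ?_).tsum_eq
  have hA := hasSum_total_le (u + c i) fun x y =>
    f x y * psi l c T statRep f q (T i (x + y)) ((u + c i - x - y : ℕ) : ℤ) n
  have hB := (hasSum_overshoot hfnn hs hfdeg (u + c i)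
    (H := fun k => psiAux l c T statRep f q (T i (u + c i + k)) 0 k n)
    (fun _ => psiAux_nonneg hfnn hq0 hq1 _ _ _ _ _)
    (fun _ => psiAux_le_one hfnn hfsum hq0 hq1 _ _ _ _ _)).mul_left q
  have hB' := (hasSum_overshoot hfnn hs hfdeg (u + c i) (H := fun _ => 1)
    (fun _ => zero_le_one) (fun _ => le_rfl)).mul_left (1 - q)
  have hC := hasSum_main_claim_gt hs (u + c i)
  simp only [mul_one] at hB'
  convert ((hA.add hB).add hB').add hC using 2 with p
  obtain ⟨x, y⟩ := p
  simp only [statRep, psi, if_true, Bool.false_eq_true, if_false, Nat.cast_zero, add_zero]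
  rcases le_or_gt (x + y) (u + c i) with h1 | h1
  · rw [if_pos h1, if_neg (by omega), if_neg (by omega), if_neg (by omega),
      psiAux_statRep_congr n _ (v := ((u + c i - x - y : ℕ) : ℤ)) (z := 0) (by omega) (by omega)
        (by omega),
      show (u : ℤ) + c i - (x + y) = ((u + c i - x - y : ℕ) : ℤ) by omega]
    ring
  rcases le_or_gt x (u + c i) with h2 | h2
  · rw [if_neg (by omega), if_pos ⟨h2, h1⟩, if_pos ⟨h2, h1⟩, if_neg (by omega),
      psiAux_statRep_congr n _ (u := (u : ℤ) + c i - x) (v := 0) (z := x + y - (u + c i))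
        (by omega) le_rfl (by omega),
      psiAux_of_neg (u := (u : ℤ) + c i - (x + y)) (by omega), Nat.add_sub_cancel' h1.le]
    ring
  · rw [if_neg (by omega), if_neg (by omega), if_neg (by omega), if_pos h2,
      psiAux_of_neg (by omega), psiAux_of_neg (by omega)]
    ring

/-- Theorem 1: recursion for ψ when premiums are adjusted according to
aggregate reported claims. -/
theorem theorem1_reported_aggregate
    (l : ℕ) (c : Fin l → ℕ) (hcpos : ∀ i, 0 < c i) (hcmono : StrictMono c)
    (f : ℕ → ℕ → ℝ) (hfnn : ∀ x y, 0 ≤ f x y)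
    (hfsum : ∑' p : ℕ × ℕ, f p.1 p.2 = 1)
    (hfdeg : ∀ y : ℕ, 0 < y → f 0 y = 0)
    (q : ℝ) (hq0 : 0 ≤ q) (hq1 : q ≤ 1)
    (t : Fin l → Fin l → ℕ → ℝ) (T : Fin l → ℕ → Fin l)
    (hT : ∀ i j s, t i j s = if j = T i s then (1 : ℝ) else 0)
    (u : ℕ) (i : Fin l) (n : ℕ) (hn : 1 ≤ n) :
    psi l c T statRep f q i (u : ℤ) (n + 1) =
        (∑ j : Fin l, ∑ x ∈ Finset.range (u + c i + 1), ∑ y ∈ Finset.range (u + c i - x + 1),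
          t i j (x + y) * psi l c T statRep f q j ((u + c i - x - y : ℕ) : ℤ) n * f x y)
      + q * (∑ j : Fin l, ∑ y ∈ Finset.Icc 1 (c j),
          t i j (u + c i + y) * psiAux l c T statRep f q j 0 y n * xi f y (u + c i))
      + q * (∑ j : Fin l, ∑' k : ℕ,
          t i j (u + c i + (c j + 1 + k)) * xi f (c j + 1 + k) (u + c i))
      + (1 - q) * (∑' k : ℕ, xi f (k + 1) (u + c i))
      + (∑' k : ℕ, fX f (u + c i + 1 + k)) ∧
    psi l c T statRep f q i (u : ℤ) 1 =
      (1 - q) * (∑' k : ℕ, xi f (k + 1) (u + c i))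
      + (∑' k : ℕ, fX f (u + c i + 1 + k)) := by
  have hs := summable_pmf hfsum
  have hsel : ∀ (s : ℕ) (g : Fin l → ℝ), ∑ j, t i j s * g j = g (T i s) := by
    intro s g
    simp [hT]
  constructor
  · rw [psi_statRep_succ hfnn hfsum hfdeg hq0 hq1, add_left_inj, add_left_inj,
      add_assoc (Finset.sum _ _), ← mul_add, ← Finset.sum_add_distrib]
    refine congr_arg₂ (· + ·) ?_ (congrArg (q * ·) ?_)
    · rw [Finset.sum_comm]
      refine Finset.sum_congr rfl fun x _ => ?_
      rw [Finset.sum_comm]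
      refine Finset.sum_congr rfl fun y _ => ?_
      simp only [mul_assoc]
      rw [hsel, mul_comm]
    · have hsum : ∀ j, Summable fun k : ℕ => t i j (u + c i + (k + 1)) *
          (psiAux l c T statRep f q j 0 (k + 1) n * xi f (k + 1) (u + c i)) := by
        intro j
        refine (summable_xi hs hfdeg (u + c i)).of_nonneg_of_le (fun k => ?_) (fun k => ?_)
        all_goals
          have h0 := xi_nonneg hfnn (k + 1) (u + c i)
          have h1 := psiAux_nonneg (c := c) (T := T) hfnn hq0 hq1 statRep j 0 (k + 1) n
          have h2 := psiAux_le_one (c := c) (T := T) hfnn hfsum hq0 hq1 statRep j 0 (k + 1) n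
          rw [hT]
          split_ifs
        · simpa using mul_nonneg h1 h0
        · simp
        · simpa using mul_le_of_le_one_left h0 h2
        · simpa using h0
      calc _ = ∑' k : ℕ, ∑ j, t i j (u + c i + (k + 1)) *
              (psiAux l c T statRep f q j 0 (k + 1) n * xi f (k + 1) (u + c i)) := by
            refine tsum_congr fun k => ?_
            rw [hsel, mul_comm]
        _ = _ := by
            rw [Summable.tsum_finsetSum fun j _ => hsum j]
            refine Finset.sum_congr rfl fun j _ => ?_
            rw [← (hsum j).sum_add_tsum_nat_add (c j)]
            congr 1
            · rw [Finset.range_eq_Ico, Finset.sum_Ico_add' (fun k => t i j (u + c i + k) *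
                (psiAux l c T statRep f q j 0 k n * xi f k (u + c i))) 0 (c j) 1]
              refine Finset.sum_congr rfl fun k _ => ?_
              rw [mul_assoc]
            · refine tsum_congr fun k => ?_
              rw [psiAux_eq_one hfnn hfsum hq0 hq1 statRep j (by omega) hn, one_mul,
                show k + c j + 1 = c j + 1 + k by omega]
  · rw [psi_statRep_succ hfnn hfsum hfdeg hq0 hq1]
    simp [psi, psiAux_zero]

end DelayedClaims
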